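/- Let d ≥ 1, let λ be a partition of n ≥ 1, and let ρ be a partition of dn. Then χ^{⊞^d(λ)}_{d·ρ} = Σ (∏_{i≥1} m_i(ρ)! / (m_i(τ_1)! ⋯ m_i(τ_d)!)) · χ^λ_{τ_1} ⋯ χ^λ_{τ_d}, where the sum ranges over all d-tuples (τ_1, …, τ_d) of partitions of n whose multiset union τ_1 ⊎ ⋯ ⊎ τ_d equals ρ (the sum being 0 if no such tuple exists, e.g. if ρ has a part larger than n). -/

import Mathlib

open MvPolynomial Finset

/-- The `r`-th power sum polynomial `p_r = x_1^r + ⋯ + x_N^r`. -/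
noncomputable def psum (N r : ℕ) : MvPolynomial (Fin N) ℤ := ∑ i, X i ^ r

/-- The power sum product `p_μ = p_{μ_1} ⋯ p_{μ_k}` for a partition `μ`. -/
noncomputable def pprod (N : ℕ) {n : ℕ} (mu : Nat.Partition n) : MvPolynomial (Fin N) ℤ :=
  (mu.parts.map (psum N)).prod

/-- The Vandermonde product `∏_{i<j} (x_i - x_j)`. -/
noncomputable def vandermonde (N : ℕ) : MvPolynomial (Fin N) ℤ :=
  ∏ p ∈ univ.filter (fun p : Fin N × Fin N => p.1 < p.2), (X p.1 - X p.2)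

/-- The irreducible character value `χ^λ_μ` of `S_N`, via the Frobenius character formula:
the coefficient of `x_1^{λ_1 + N - 1} x_2^{λ_2 + N - 2} ⋯ x_N^{λ_N}` in `∏_{i<j}(x_i - x_j) ⋅ p_μ`,
where `λ` is padded with trailing zeros to length `N`. -/
noncomputable def chi {N : ℕ} (l m : Nat.Partition N) : ℤ :=
  coeff (Finsupp.equivFunOnFinite.symm fun i : Fin N =>
    (l.parts.sort (· ≥ ·)).getD i 0 + (N - 1 - (i : ℕ))) (vandermonde N * pprod N m)

/-- `⊞^d(λ)`: replace each part `p` of `λ` by `d` copies of `d⋅p`; a partition of `d²n`. -/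
def boxplus (d : ℕ) {n : ℕ} (P : Nat.Partition n) : Nat.Partition (d * (d * n)) where
  parts := P.parts.bind fun p => Multiset.replicate d (d * p)
  parts_pos := by
    intro i hi
    simp only [Multiset.mem_bind, Multiset.mem_replicate] at hi
    obtain ⟨p, hp, hd, rfl⟩ := hi
    exact Nat.mul_pos (Nat.pos_of_ne_zero hd) (P.parts_pos hp)
  parts_sum := by
    rw [Multiset.sum_bind]
    simp only [Multiset.sum_replicate, smul_eq_mul]
    rw [Multiset.sum_map_mul_left, Multiset.sum_map_mul_left, Multiset.map_id', P.parts_sum]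

/-- `d⋅λ`: multiply every part of `λ` by `d`; a partition of `dn`. -/
def scale (d : ℕ) (hd : 0 < d) {n : ℕ} (P : Nat.Partition n) : Nat.Partition (d * n) where
  parts := P.parts.map (d * ·)
  parts_pos := by
    intro i hi
    obtain ⟨p, hp, rfl⟩ := Multiset.mem_map.mp hi
    exact Nat.mul_pos hd (P.parts_pos hp)
  parts_sum := by rw [Multiset.sum_map_mul_left, Multiset.map_id', P.parts_sum]

theorem vandermonde_eq_det (N : ℕ) :
    vandermonde N =
      (Matrix.of fun i j : Fin N => (X i : MvPolynomial (Fin N) ℤ) ^ (N - 1 - (j : ℕ))).det := by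
  have h : (Matrix.of fun i j : Fin N => (X i : MvPolynomial (Fin N) ℤ) ^ (N - 1 - (j : ℕ))) =
      (Matrix.vandermonde fun i : Fin N => (X i.rev : MvPolynomial (Fin N) ℤ)).submatrix
        Fin.revPerm Fin.revPerm := by
    ext1 i j
    simp only [Matrix.of_apply, Matrix.submatrix_apply, Matrix.vandermonde_apply,
      Fin.revPerm_apply, Fin.rev_rev, Fin.val_rev]
    congr 1
    omega
  rw [h, Matrix.det_submatrix_equiv_self, Matrix.det_vandermonde, vandermonde]
  rw [Finset.prod_sigma']
  refine Finset.prod_bij' (fun p _ => ⟨p.2.rev, p.1.rev⟩) (fun p _ => (p.2.rev, p.1.rev))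
    ?_ ?_ ?_ ?_ ?_ <;> simp

theorem coeff_vandermonde (N : ℕ) (b : Fin N →₀ ℕ) :
    coeff b (vandermonde N) =
      (Matrix.of fun i j : Fin N => if b i = N - 1 - (j : ℕ) then (1 : ℤ) else 0).det := by
  rw [vandermonde_eq_det, Matrix.det_apply', Matrix.det_apply', coeff_sum]
  refine Finset.sum_congr rfl fun σ _ => ?_
  have h : ∏ i : Fin N, (X (σ i) : MvPolynomial (Fin N) ℤ) ^ (N - 1 - (i : ℕ)) =
      monomial (Finsupp.equivFunOnFinite.symm fun i => N - 1 - (σ.symm i : ℕ)) 1 := by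
    rw [monomial_eq, C_1, one_mul, Finsupp.prod_fintype _ _ (by simp),
      ← Equiv.prod_comp σ fun i => (X i : MvPolynomial (Fin N) ℤ) ^ _]
    simp
  simp only [Matrix.of_apply]
  rw [h, ← eq_intCast (C : ℤ →+* MvPolynomial (Fin N) ℤ), coeff_C_mul, coeff_monomial,
    Finset.prod_ite_zero]
  simp only [Int.cast_id, Finset.prod_const_one]
  congr 1
  refine if_congr ?_ rfl rfl
  rw [eq_comm, Finsupp.ext_iff, ← σ.forall_congr_right]
  simp

/-- The exponent `λ + δ` in `m` variables. -/
noncomputable def shiftedExponent (m : ℕ) (L : List ℕ) : Fin m →₀ ℕ :=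
  Finsupp.equivFunOnFinite.symm fun i : Fin m => L.getD i 0 + (m - 1 - (i : ℕ))

/-- The coefficient of `x^(λ + δ)` in the product of the Vandermonde determinant and `p_s`,
in `m` variables. -/
noncomputable def alternantCoeff (m : ℕ) (L : List ℕ) (s : Multiset ℕ) : ℤ :=
  coeff (shiftedExponent m L) (vandermonde m * (s.map (_root_.psum m)).prod)

theorem psum_isHomogeneous (m k : ℕ) : (_root_.psum m k).IsHomogeneous k :=
  IsHomogeneous.sum _ _ _ fun i _ => by simpa using (isHomogeneous_X ℤ i).pow k

theorem prod_psum_isHomogeneous (m : ℕ) (s : Multiset ℕ) :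
    ((s.map (_root_.psum m)).prod).IsHomogeneous s.sum := by
  induction s using Multiset.induction_on with
  | empty => simpa using isHomogeneous_one (Fin m) ℤ
  | cons k s ih => simpa using (psum_isHomogeneous m k).mul ih

theorem vandermonde_isHomogeneous (m : ℕ) :
    (vandermonde m).IsHomogeneous (∑ i : Fin m, (m - 1 - (i : ℕ))) := by
  rw [vandermonde_eq_det, Matrix.det_apply']
  refine IsHomogeneous.sum _ _ _ fun σ _ => ?_
  rw [← eq_intCast (C : ℤ →+* MvPolynomial (Fin m) ℤ)]
  refine IsHomogeneous.C_mul (IsHomogeneous.prod _ _ _ fun i _ => ?_) _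
  simpa using (isHomogeneous_X ℤ (σ i)).pow (m - 1 - (i : ℕ))

theorem List.sum_fin_getD {m : ℕ} {L : List ℕ} (h : L.length ≤ m) :
    ∑ i : Fin m, L.getD i 0 = L.sum := by
  rw [← Finset.sum_range fun i => L.getD i 0, ← Finset.sum_subset (Finset.range_subset_range.2 h),
    Finset.sum_range, ← List.sum_ofFn]
  · congr 1
    refine List.ext_getElem (by simp) fun i h1 h2 => ?_
    simp
  · intro i _ hi
    simp at hi
    simp [hi]

theorem alternantCoeff_eq_zero {m : ℕ} {L : List ℕ} {s : Multiset ℕ} (hL : L.length ≤ m)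
    (h : s.sum ≠ L.sum) : alternantCoeff m L s = 0 := by
  refine ((vandermonde_isHomogeneous m).mul (prod_psum_isHomogeneous m s)).coeff_eq_zero ?_
  rw [Finsupp.degree_eq_sum]
  simp only [shiftedExponent, Finsupp.equivFunOnFinite_symm_apply_apply, Finset.sum_add_distrib,
    List.sum_fin_getD hL]
  omega

theorem killCompl_castSucc_last (m : ℕ) :
    killCompl (R := ℤ) (Fin.castSucc_injective m) (X (Fin.last m)) = 0 := by
  simp [killCompl]

theorem killCompl_castSucc_X {m : ℕ} (i : Fin m) :
    killCompl (R := ℤ) (Fin.castSucc_injective m) (X i.castSucc) = X i := by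
  simpa using killCompl_rename_app (Fin.castSucc_injective m) (X i : MvPolynomial (Fin m) ℤ)

theorem killCompl_psum (m : ℕ) {k : ℕ} (hk : k ≠ 0) :
    killCompl (Fin.castSucc_injective m) (_root_.psum (m + 1) k) = _root_.psum m k := by
  simp [_root_.psum, Fin.sum_univ_castSucc, killCompl_castSucc_X, killCompl_castSucc_last, hk]

theorem vandermonde_eq_prod_ite (N : ℕ) :
    vandermonde N = ∏ i, ∏ j, if i < j then X i - X j else 1 := by
  rw [vandermonde, Finset.prod_filter, ← Finset.univ_product_univ, Finset.prod_product]

theorem killCompl_vandermonde (m : ℕ) :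
    killCompl (Fin.castSucc_injective m) (vandermonde (m + 1)) = vandermonde m * ∏ i, X i := by
  simp [vandermonde_eq_prod_ite, Fin.prod_univ_castSucc, Finset.prod_mul_distrib, apply_ite,
    killCompl_castSucc_X, killCompl_castSucc_last, Fin.castSucc_lt_last, not_lt.2 (Fin.le_last _)]

theorem alternantCoeff_succ {m : ℕ} {L : List ℕ} {s : Multiset ℕ} (hL : L.length ≤ m)
    (hs : 0 ∉ s) : alternantCoeff (m + 1) L s = alternantCoeff m L s := by
  have hp : killCompl (Fin.castSucc_injective m) ((s.map (_root_.psum (m + 1))).prod) =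
      (s.map (_root_.psum m)).prod := by
    rw [map_multiset_prod, Multiset.map_map]
    exact congrArg _ (Multiset.map_congr rfl fun k hk =>
      killCompl_psum m (ne_of_mem_of_not_mem hk hs))
  have hX : ∏ i : Fin m, (X i : MvPolynomial (Fin m) ℤ) =
      monomial (Finsupp.equivFunOnFinite.symm fun _ => 1) 1 := by
    rw [monomial_eq, C_1, one_mul, Finsupp.prod_fintype _ _ (by simp)]
    simp
  have he : shiftedExponent (m + 1) L = (shiftedExponent m L +
      Finsupp.equivFunOnFinite.symm fun _ => 1).mapDomain Fin.castSucc := by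
    ext i
    refine Fin.lastCases ?_ (fun i => ?_) i
    · rw [Finsupp.mapDomain_of_notMem_range _ _ (by simp)]
      simp [shiftedExponent, hL]
    · rw [Finsupp.mapDomain_apply (Fin.castSucc_injective m)]
      simp [shiftedExponent]
      omega
  rw [alternantCoeff, he, ← coeff_killCompl (Fin.castSucc_injective m), map_mul, hp,
    killCompl_vandermonde, hX, mul_right_comm, coeff_mul_monomial, mul_one, alternantCoeff]

theorem alternantCoeff_eq_of_le {n m : ℕ} (h : n ≤ m) {L : List ℕ} {s : Multiset ℕ}
    (hL : L.length ≤ n) (hs : 0 ∉ s) : alternantCoeff m L s = alternantCoeff n L s := by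
  induction m, h using Nat.le_induction with
  | base => rfl
  | succ m hm ih => rw [alternantCoeff_succ (hL.trans hm) hs, ih]

theorem coeff_mul_sum_X_pow {ι : Type*} [Fintype ι] (f : MvPolynomial ι ℤ) (k : ℕ) (b : ι →₀ ℕ) :
    coeff b (f * ∑ i, X i ^ k) =
      ∑ i, if k ≤ b i then coeff (b - Finsupp.single i k) f else 0 := by
  simp [Finset.mul_sum, coeff_sum, X_pow_eq_monomial, coeff_mul_monomial', Finsupp.single_le_iff]

/-- The equivalence `(a, b) ↦ d * a + b`. -/
def blockEquiv (m d : ℕ) : Fin m × Fin d ≃ Fin (d * m) :=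
  finProdFinEquiv.trans (finCongr (mul_comm m d))

theorem blockEquiv_val {m d : ℕ} (p : Fin m × Fin d) :
    (blockEquiv m d p : ℕ) = p.2 + d * p.1 := rfl

/-- The exponent of `x_{d * a + b}` is `d * α (a, b) + (d - 1 - b)`. -/
noncomputable def dilate {m d : ℕ} (a : Fin m × Fin d →₀ ℕ) : Fin (d * m) →₀ ℕ :=
  Finsupp.equivFunOnFinite.symm fun i =>
    d * a ((blockEquiv m d).symm i) + (d - 1 - (((blockEquiv m d).symm i).2 : ℕ))

theorem dilate_apply {m d : ℕ} (a : Fin m × Fin d →₀ ℕ) (p : Fin m × Fin d) :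
    dilate a (blockEquiv m d p) = d * a p + (d - 1 - (p.2 : ℕ)) := by
  simp [dilate]

theorem dilate_sub_single {m d : ℕ} (a : Fin m × Fin d →₀ ℕ) (p : Fin m × Fin d) {k : ℕ}
    (hk : k ≤ a p) :
    dilate a - Finsupp.single (blockEquiv m d p) (d * k) = dilate (a - Finsupp.single p k) := by
  ext i
  obtain ⟨q, rfl⟩ := (blockEquiv m d).surjective i
  rw [Finsupp.tsub_apply, dilate_apply, dilate_apply, Finsupp.tsub_apply]
  by_cases h : p = q
  · subst h
    have := Nat.mul_le_mul_left d hk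
    simp only [Finsupp.single_eq_same, Nat.mul_sub]
    omega
  · rw [Finsupp.single_eq_of_ne (by simpa using Ne.symm h), Finsupp.single_eq_of_ne (Ne.symm h)]
    simp

theorem le_dilate_iff {m d : ℕ} (a : Fin m × Fin d →₀ ℕ) (p : Fin m × Fin d) (k : ℕ) :
    d * k ≤ dilate a (blockEquiv m d p) ↔ k ≤ a p := by
  have hp := p.2.isLt
  rw [dilate_apply]
  refine ⟨fun h => ?_, fun h => (Nat.mul_le_mul_left d h).trans (Nat.le_add_right _ _)⟩
  refine Nat.lt_succ_iff.1 (lt_of_mul_lt_mul_left (a := d) ?_ d.zero_le)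
  rw [Nat.mul_succ]
  omega

theorem coeff_dilate_mul_prod_psum {m d : ℕ} {f : MvPolynomial (Fin (d * m)) ℤ}
    {g : MvPolynomial (Fin m × Fin d) ℤ} (h : ∀ a, coeff (dilate a) f = coeff a g)
    (s : Multiset ℕ) (a : Fin m × Fin d →₀ ℕ) :
    coeff (dilate a) (f * (s.map fun k => _root_.psum (d * m) (d * k)).prod) =
      coeff a (g * (s.map fun k => ∑ p, X p ^ k).prod) := by
  induction s using Multiset.induction_on generalizing f g with
  | empty => simpa using h a
  | cons k s ih =>
    rw [Multiset.map_cons, Multiset.prod_cons, Multiset.map_cons, Multiset.prod_cons,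
      ← mul_assoc, ← mul_assoc]
    refine ih fun a => ?_
    rw [_root_.psum, coeff_mul_sum_X_pow, coeff_mul_sum_X_pow, ← (blockEquiv m d).sum_comp]
    refine Finset.sum_congr rfl fun p _ => ?_
    by_cases hk : k ≤ a p
    · rw [if_pos ((le_dilate_iff a p k).2 hk), if_pos hk, dilate_sub_single a p hk, h]
    · rw [if_neg (mt (le_dilate_iff a p k).1 hk), if_neg hk]

/-- The exponents of the variables in the `b`-th block. -/
noncomputable def blockExponent {m d : ℕ} (a : Fin m × Fin d →₀ ℕ) (b : Fin d) : Fin m →₀ ℕ :=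
  Finsupp.equivFunOnFinite.symm fun i => a (i, b)

theorem coeff_prod_rename {m d : ℕ} (f : Fin d → MvPolynomial (Fin m) ℤ)
    (a : Fin m × Fin d →₀ ℕ) :
    coeff a (∏ b, rename (fun i => (i, b)) (f b)) = ∏ b, coeff (blockExponent a b) (f b) := by
  have hinj (b : Fin d) : Function.Injective fun i : Fin m => (i, b) :=
    fun i j h => (Prod.ext_iff.1 h).1
  have hmon (s : Fin d → Fin m →₀ ℕ) (c : Fin d → ℤ) :
      ∏ b, monomial ((s b).mapDomain fun i => (i, b)) (c b) =
        monomial (∑ b, (s b).mapDomain fun i => (i, b)) (∏ b, c b) := by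
    induction (Finset.univ : Finset (Fin d)) using Finset.induction_on with
    | empty => simp
    | insert b t hb ih => rw [Finset.prod_insert hb, Finset.sum_insert hb, Finset.prod_insert hb, ih,
        monomial_mul]
  have hext (s : Fin d → Fin m →₀ ℕ) :
      ∑ b, (s b).mapDomain (fun i => (i, b)) = a ↔ s = blockExponent a := by
    have happ (p : Fin m × Fin d) :
        (∑ b, (s b).mapDomain (fun i => (i, b))) p = s p.2 p.1 := by
      rw [Finsupp.finsetSum_apply, Finset.sum_eq_single p.2]
      · exact Finsupp.mapDomain_apply (hinj p.2) _ p.1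
      · intro b _ hb
        refine Finsupp.mapDomain_of_notMem_range _ _ ?_
        rintro ⟨i, rfl⟩
        exact hb rfl
      · simp
    rw [Finsupp.ext_iff, _root_.funext_iff]
    simp only [happ, Finsupp.ext_iff, Prod.forall, blockExponent,
      Finsupp.equivFunOnFinite_symm_apply_apply]
    exact forall_comm
  have hf (b : Fin d) : rename (fun i => (i, b)) (f b) =
      ∑ s ∈ (f b).support, monomial (s.mapDomain fun i => (i, b)) (coeff s (f b)) := by
    conv_lhs => rw [(f b).as_sum, map_sum]
    simp_rw [rename_monomial]
  simp_rw [hf, Finset.prod_univ_sum, hmon, coeff_sum, coeff_monomial, hext]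
  rw [Finset.sum_ite_eq']
  split_ifs with h
  · rfl
  · simp only [Fintype.mem_piFinset, not_forall, notMem_support_iff] at h
    obtain ⟨b, hb⟩ := h
    exact (Finset.prod_eq_zero (Finset.mem_univ b) hb).symm

theorem coeff_dilate_vandermonde {m d : ℕ} (a : Fin m × Fin d →₀ ℕ) :
    coeff (dilate a) (vandermonde (d * m)) =
      coeff a (∏ b : Fin d, rename (fun i => (i, b)) (vandermonde m)) := by
  rw [coeff_prod_rename, coeff_vandermonde]
  simp_rw [coeff_vandermonde]
  rw [← Matrix.det_blockDiagonal, ← Matrix.det_submatrix_equiv_self (blockEquiv m d)]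
  congr 1
  ext p q
  rw [Matrix.submatrix_apply, Matrix.of_apply, dilate_apply, Matrix.blockDiagonal_apply,
    blockEquiv_val]
  obtain ⟨i, b⟩ := p
  obtain ⟨j, c⟩ := q
  have hb := b.isLt
  have hc := c.isLt
  have hj : d * j + d * (m - 1 - j) + d = d * m := by
    rw [← Nat.mul_add, ← Nat.mul_succ]
    congr 1
    omega
  have key : d * m - 1 - (c + d * j) = d * (m - 1 - j) + (d - 1 - c) := by omega
  simp only [key, Matrix.of_apply, blockExponent, Finsupp.equivFunOnFinite_symm_apply_apply]
  rw [← ite_and]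
  refine if_congr ⟨fun h => ?_, ?_⟩ rfl rfl
  · have h1 := congrArg (· % d) h
    have h2 := congrArg (· / d) h
    simp only [Nat.mul_add_mod, Nat.mod_eq_of_lt (show d - 1 - (b : ℕ) < d by omega),
      Nat.mod_eq_of_lt (show d - 1 - (c : ℕ) < d by omega)] at h1
    simp only [Nat.mul_add_div (show 0 < d by omega),
      Nat.div_eq_of_lt (show d - 1 - (b : ℕ) < d by omega),
      Nat.div_eq_of_lt (show d - 1 - (c : ℕ) < d by omega)] at h2
    exact ⟨by ext; omega, h2⟩
  · rintro ⟨rfl, h⟩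
    rw [h]

theorem sum_X_pow_eq_sum_rename_psum (m d k : ℕ) :
    ∑ p : Fin m × Fin d, (X p : MvPolynomial (Fin m × Fin d) ℤ) ^ k =
      ∑ b : Fin d, rename (fun i => (i, b)) (_root_.psum m k) := by
  simp [_root_.psum, Fintype.sum_prod_type_right]

theorem List.getD_flatMap_replicate {d : ℕ} (L : List ℕ) (a : ℕ) {b : ℕ} (hb : b < d) :
    (L.flatMap fun p => List.replicate d (d * p)).getD (b + d * a) 0 = d * L.getD a 0 := by
  induction L generalizing a with
  | nil => simp
  | cons x L ih =>
    rw [List.flatMap_cons]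
    cases a with
    | zero =>
      rw [List.getD_append _ _ _ _ (by simpa using hb)]
      simp [hb]
    | succ a =>
      rw [List.getD_append_right _ _ _ _ (by simp; nlinarith), List.length_replicate,
        show b + d * (a + 1) - d = b + d * a by rw [Nat.mul_succ]; omega, ih]
      simp

theorem sort_parts_boxplus (d : ℕ) {n : ℕ} (P : Nat.Partition n) :
    (boxplus d P).parts.sort (· ≥ ·) =
      (P.parts.sort (· ≥ ·)).flatMap fun p => List.replicate d (d * p) := by
  refine List.Perm.eq_of_pairwise' (r := (· ≥ ·)) (Multiset.pairwise_sort _ _) ?_ ?_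
  · rw [List.pairwise_flatMap]
    refine ⟨fun p _ => List.pairwise_replicate.2 (Or.inr le_rfl), ?_⟩
    refine (Multiset.pairwise_sort P.parts (· ≥ ·)).imp fun {p q} h x hx y hy => ?_
    rw [List.eq_of_mem_replicate hx, List.eq_of_mem_replicate hy]
    exact Nat.mul_le_mul_left d h
  · rw [← Multiset.coe_eq_coe, Multiset.sort_eq]
    change P.parts.bind _ = _
    conv_lhs => rw [← Multiset.sort_eq P.parts (· ≥ ·)]
    simp [← Multiset.coe_bind, ← Multiset.coe_replicate]

/-- The multiset in which `k < N` has multiplicity `p k`. -/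
def ofMultiplicities {N : ℕ} (p : Fin N → ℕ) : Multiset ℕ :=
  ∑ k, Multiset.replicate (p k) (k : ℕ)

theorem count_ofMultiplicities {N : ℕ} (p : Fin N → ℕ) (k : Fin N) :
    (ofMultiplicities p).count (k : ℕ) = p k := by
  simp [ofMultiplicities, Multiset.count_sum', Multiset.count_replicate, Fin.val_inj]

theorem lt_of_mem_ofMultiplicities {N : ℕ} {p : Fin N → ℕ} {k : ℕ}
    (hk : k ∈ ofMultiplicities p) : k < N := by
  obtain ⟨i, -, hi⟩ := Multiset.mem_sum.1 hk
  rw [Multiset.eq_of_mem_replicate hi]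
  exact i.isLt

theorem ext_of_count_lt {N : ℕ} {s t : Multiset ℕ} (hs : ∀ k ∈ s, k < N) (ht : ∀ k ∈ t, k < N)
    (h : ∀ k : Fin N, s.count (k : ℕ) = t.count (k : ℕ)) : s = t := by
  ext k
  by_cases hk : k < N
  · exact h ⟨k, hk⟩
  · rw [Multiset.count_eq_zero_of_notMem (mt (hs k) hk),
      Multiset.count_eq_zero_of_notMem (mt (ht k) hk)]

theorem prod_map_ofMultiplicities {R : Type*} [CommSemiring R] {N : ℕ} (p : Fin N → ℕ)
    (F : ℕ → R) : ((ofMultiplicities p).map F).prod = ∏ k : Fin N, F k ^ p k := by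
  rw [ofMultiplicities, ← Multiset.coe_mapAddMonoidHom, map_sum, Multiset.prod_sum]
  simp

theorem ofMultiplicities_count {N : ℕ} {s : Multiset ℕ} (hs : ∀ k ∈ s, k < N) :
    ofMultiplicities (fun k : Fin N => s.count (k : ℕ)) = s :=
  ext_of_count_lt (fun _ => lt_of_mem_ofMultiplicities) hs fun k => count_ofMultiplicities _ k

theorem prod_map_sum_eq_sum_multinomial {R : Type*} [CommSemiring R] {d N : ℕ} {s : Multiset ℕ}
    (hs : ∀ k ∈ s, k < N) (F : Fin d → ℕ → R) :
    (s.map fun k => ∑ b, F b k).prod =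
      ∑ p ∈ Fintype.piFinset fun k : Fin N => Finset.piAntidiag univ (s.count (k : ℕ)),
        ((∏ k, Nat.multinomial univ (p k) : ℕ) : R) *
          ∏ b, ((ofMultiplicities fun k => p k b).map (F b)).prod := by
  conv_lhs => rw [← ofMultiplicities_count hs]
  rw [prod_map_ofMultiplicities]
  simp_rw [Finset.sum_pow_eq_sum_piAntidiag, Finset.prod_univ_sum, prod_map_ofMultiplicities]
  refine Finset.sum_congr rfl fun p _ => ?_
  rw [Finset.prod_mul_distrib, Finset.prod_comm, Nat.cast_prod]

theorem chi_eq_alternantCoeff {N : ℕ} (l m : Nat.Partition N) :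
    chi l m = alternantCoeff N (l.parts.sort (· ≥ ·)) m.parts := rfl

theorem chi_boxplus_scale_eq_coeff (d n : ℕ) (hd : 1 ≤ d)
    (lam : Nat.Partition n) (rho : Nat.Partition (d * n)) :
    chi (boxplus d lam) (scale d hd rho) =
      coeff (Finsupp.equivFunOnFinite.symm fun p : Fin (d * n) × Fin d =>
          shiftedExponent (d * n) (lam.parts.sort (· ≥ ·)) p.1)
        ((∏ b : Fin d, rename (fun i => (i, b)) (vandermonde (d * n))) *
          (rho.parts.map fun k => ∑ p, X p ^ k).prod) := by
  rw [← coeff_dilate_mul_prod_psum coeff_dilate_vandermonde, chi_eq_alternantCoeff,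
    alternantCoeff]
  congr 1
  · ext i
    obtain ⟨⟨a, b⟩, rfl⟩ := (blockEquiv (d * n) d).surjective i
    rw [dilate_apply, sort_parts_boxplus]
    simp only [shiftedExponent, Finsupp.equivFunOnFinite_symm_apply_apply, blockEquiv_val,
      List.getD_flatMap_replicate _ _ b.isLt, Nat.mul_add]
    have hb := b.isLt
    have ha : d * a + d * (d * n - 1 - a) + d = d * (d * n) := by
      rw [← Nat.mul_add, ← Nat.mul_succ]
      congr 1
      omega
    omega
  · rw [scale, Multiset.map_map]
    rfl

theorem chi_boxplus_scale_eq_sum_multinomial (d n : ℕ) (hd : 1 ≤ d)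
    (lam : Nat.Partition n) (rho : Nat.Partition (d * n)) :
    chi (boxplus d lam) (scale d hd rho) =
      ∑ p ∈ Fintype.piFinset fun k : Fin (d * n + 1) =>
          Finset.piAntidiag (univ : Finset (Fin d)) (rho.parts.count (k : ℕ)),
        ((∏ k, Nat.multinomial univ (p k) : ℕ) : ℤ) *
          ∏ b, alternantCoeff (d * n) (lam.parts.sort (· ≥ ·)) (ofMultiplicities fun k => p k b) := by
  rw [chi_boxplus_scale_eq_coeff]
  simp_rw [sum_X_pow_eq_sum_rename_psum]
  rw [prod_map_sum_eq_sum_multinomial (N := d * n + 1)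
    (fun k hk => Nat.lt_succ_iff.2 (Nat.Partition.le_of_mem_parts hk)), Finset.mul_sum, coeff_sum]
  refine Finset.sum_congr rfl fun p _ => ?_
  rw [mul_left_comm, ← Finset.prod_mul_distrib,
    ← map_natCast (C : ℤ →+* MvPolynomial (Fin (d * n) × Fin d) ℤ), coeff_C_mul]
  congr 1
  have h (b : Fin d) : rename (fun i => (i, b)) (vandermonde (d * n)) *
        ((ofMultiplicities fun k => p k b).map fun k =>
          rename (fun i => (i, b)) (_root_.psum (d * n) k)).prod =
      rename (fun i => (i, b)) (vandermonde (d * n) *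
        ((ofMultiplicities fun k => p k b).map (_root_.psum (d * n))).prod) := by
    rw [map_mul, map_multiset_prod, Multiset.map_map]
    rfl
  simp_rw [h]
  rw [coeff_prod_rename]
  rfl

theorem Nat.Partition.length_sort_parts_le {n : ℕ} (P : Nat.Partition n) :
    (P.parts.sort (· ≥ ·)).length ≤ n := by
  rw [Multiset.length_sort]
  have h := Multiset.card_nsmul_le_sum (s := P.parts) (a := 1) fun k hk => P.parts_pos hk
  rwa [P.parts_sum, smul_eq_mul, mul_one] at h

theorem Nat.Partition.sum_sort_parts {n : ℕ} (P : Nat.Partition n) :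
    (P.parts.sort (· ≥ ·)).sum = n := by
  rw [← Multiset.sum_coe, Multiset.sort_eq, P.parts_sum]

/-- For `d ≥ 1`, `λ ⊢ n ≥ 1` and `ρ ⊢ dn`,
`χ^{⊞^d(λ)}_{d·ρ} = Σ (∏_i m_i(ρ)!/(m_i(τ_1)!⋯m_i(τ_d)!)) χ^λ_{τ_1} ⋯ χ^λ_{τ_d}`,
summed over `d`-tuples `(τ_1, …, τ_d)` of partitions of `n` whose multiset union is `ρ`. -/
theorem boxplus_char_value_at_scaled (d n : ℕ) (hd : 1 ≤ d) (hn : 1 ≤ n)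
    (lam : Nat.Partition n) (rho : Nat.Partition (d * n)) :
    chi (boxplus d lam) (scale d hd rho) =
      ∑ τ ∈ Finset.univ.filter
          (fun τ : Fin d → Nat.Partition n => (∑ j, (τ j).parts) = rho.parts),
        ((∏ i ∈ Finset.range (d * n + 1),
            (rho.parts.count i).factorial / ∏ j, ((τ j).parts.count i).factorial : ℕ) : ℤ)
          * ∏ j, chi lam (τ j) := by
  have hlt {k : ℕ} (hk : k ∈ rho.parts) : k < d * n + 1 :=
    Nat.lt_succ_iff.2 (Nat.Partition.le_of_mem_parts hk)
  have hnd : n ≤ d * n := Nat.le_mul_of_pos_left n hd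
  have hτ (t : Nat.Partition n) {k : ℕ} (hk : k ∈ t.parts) : k < d * n + 1 :=
    Nat.lt_succ_iff.2 ((Nat.Partition.le_of_mem_parts hk).trans hnd)
  rw [chi_boxplus_scale_eq_sum_multinomial]
  symm
  refine Finset.sum_of_injOn (fun τ k b => (τ b).parts.count (k : ℕ)) ?_ ?_ ?_ ?_
  · intro τ _ τ' _ h
    refine funext fun b => Nat.Partition.ext
      (ext_of_count_lt (fun k => hτ (τ b)) (fun k => hτ (τ' b)) fun k => ?_)
    exact congrFun (congrFun h k) b
  · intro τ h
    have h : ∑ b, (τ b).parts = rho.parts := by simpa using h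
    simp [← h, Multiset.count_sum']
  · intro p hp hp'
    have hp (k : Fin (d * n + 1)) : ∑ b, p k b = rho.parts.count (k : ℕ) := by
      simpa using Fintype.mem_piFinset.1 hp k
    by_contra h0
    have hsum (b : Fin d) : (ofMultiplicities fun k => p k b).sum = n := by
      by_contra hb
      refine h0 (mul_eq_zero_of_right _ (Finset.prod_eq_zero (Finset.mem_univ b) ?_))
      refine alternantCoeff_eq_zero (lam.length_sort_parts_le.trans hnd) ?_
      rwa [lam.sum_sort_parts]
    have hpos (b : Fin d) {k : ℕ} (hk : k ∈ ofMultiplicities fun k => p k b) : 0 < k := by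
      refine Nat.pos_of_ne_zero ?_
      rintro rfl
      have h1 := hp 0
      rw [Fin.val_zero, Multiset.count_eq_zero_of_notMem fun h => (rho.parts_pos h).false,
        Finset.sum_eq_zero_iff] at h1
      refine Multiset.count_ne_zero.2 hk ?_
      exact (count_ofMultiplicities (fun k => p k b) 0).trans (h1 b (Finset.mem_univ b))
    refine hp' ⟨fun b => ⟨ofMultiplicities fun k => p k b, hpos b, hsum b⟩, ?_, ?_⟩
    · simp only [Finset.coe_filter, Finset.mem_univ, true_and, Set.mem_ofPred_eq]
      refine ext_of_count_lt (N := d * n + 1) (fun k hk => ?_) (fun k => hlt) fun k => ?_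
      · obtain ⟨b, -, hb⟩ := Multiset.mem_sum.1 hk
        exact lt_of_mem_ofMultiplicities hb
      · simp [Multiset.count_sum', count_ofMultiplicities, hp]
    · funext k b
      exact count_ofMultiplicities _ k
  · intro τ h
    have h : ∑ b, (τ b).parts = rho.parts := by simpa using h
    congr 1
    · rw [Finset.prod_range]
      simp [Nat.multinomial, ← h, Multiset.count_sum']
    · refine Finset.prod_congr rfl fun b _ => ?_
      rw [ofMultiplicities_count fun k => hτ (τ b), chi_eq_alternantCoeff,
        alternantCoeff_eq_of_le hnd lam.length_sort_parts_le
          fun h => ((τ b).parts_pos h).false]
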